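/- arXiv:2501.03961 — 3 statements merged into one kernel-verified Lean document; each statement's English description precedes it below -/
import Mathlib

section
/- Let q be a prime power and F_q the field with q elements. Let α ≥ 2, h ≥ 1, ℓ ≥ 1, t ≥ 1 and ε ≥ 0 be integers with h − ε ≥ 2ℓ. Let S be a finite collection of linear subspaces of F_q^{ht} containing at least α subspaces, such that (i) every subspace in S has dimension at most ℓt, and (ii) any α distinct subspaces from S together span a subspace of dimension at least (h−ε)t. Then αℓ ≥ h − ε, and |S| ≤ G_q((ε+ℓ)t, εt) · ((α − ⌊(h−ε)/ℓ⌋ + 1)·(q^{ℓt+1} − 1)/(q − 1) − 1) + ⌊(h−ε)/ℓ⌋ − 1. -/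
/-- The Gaussian binomial coefficient `[n choose k]_q`: the number of `k`-dimensional
`F`-linear subspaces of `F^n`, where `q` is the cardinality of `F`. -/
noncomputable def gaussBinom (F : Type*) [Field F] [Fintype F] (n k : ℕ) : ℕ :=
  Nat.card {W : Submodule F (Fin n → F) // Module.finrank F W = k}

open Module in
lemma aux_between {F V : Type*} [Field F] [AddCommGroup V] [Module F V] [FiniteDimensional F V]
    (A B : Submodule F V) (hAB : A ≤ B) (k : ℕ) (hk : finrank F A + k ≤ finrank F B) :
    ∃ C : Submodule F V, A ≤ C ∧ C ≤ B ∧ finrank F C = finrank F A + k := by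
  induction k with
  | zero => exact ⟨A, le_rfl, hAB, rfl⟩
  | succ k ih =>
    obtain ⟨C, hAC, hCB, hC⟩ := ih (by omega)
    have hnot : ¬ B ≤ C := fun hle => by
      have := Submodule.finrank_mono hle
      omega
    obtain ⟨v, hvB, hvC⟩ := SetLike.not_le_iff_exists.1 hnot
    refine ⟨C ⊔ Submodule.span F {v}, hAC.trans le_sup_left, sup_le hCB ?_, ?_⟩
    · simpa using hvB
    · have := Submodule.finrank_sup_span_singleton (K := F) hvC
      omega

open Module in
lemma aux_equiv {F D : Type*} [Field F] [AddCommGroup D] [Module F D] [FiniteDimensional F D]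
    (A : Submodule F D) (n : ℕ) (hA : finrank F A = n) : Nonempty (A ≃ₗ[F] (Fin n → F)) :=
  ⟨LinearEquiv.ofFinrankEq _ _ (by rw [hA]; simp)⟩

open Module in
lemma aux_count {F V : Type*} [Field F] [Fintype F] [AddCommGroup V] [Module F V]
    [FiniteDimensional F V] (T L : Submodule F V) (hTL : T ≤ L) (k e : ℕ)
    (hL : finrank F L = finrank F T + (k + e)) :
    Nat.card {H : Submodule F V // T ≤ H ∧ H ≤ L ∧ finrank F H = finrank F T + k}
      ≤ gaussBinom F (k + e) e := by
  have hcom : ∀ H : Submodule F V, H ≤ L → finrank F (H.comap L.subtype) = finrank F H :=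
    fun H h => (Submodule.comapSubtypeEquivOfLe h).finrank_eq
  have hTann : finrank F (T.comap L.subtype).dualAnnihilator = k + e := by
    have h1 := Subspace.finrank_add_finrank_dualAnnihilator_eq (T.comap L.subtype)
    have h2 := hcom T hTL
    omega
  obtain ⟨φ⟩ : Nonempty ((T.comap L.subtype).dualAnnihilator ≃ₗ[F] (Fin (k + e) → F)) :=
    aux_equiv (D := Module.Dual F L) _ _ hTann
  have hann : ∀ H : Submodule F V, T ≤ H →
      (H.comap L.subtype).dualAnnihilator ≤ (T.comap L.subtype).dualAnnihilator :=
    fun H h => Submodule.dualAnnihilator_anti (Submodule.comap_mono h)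
  have : Finite (Fin (k + e) → F) := inferInstance
  have : Finite {W : Submodule F (Fin (k + e) → F) // finrank F W = e} := inferInstance
  refine Nat.card_le_card_of_injective
    (fun H => (⟨(((H.1.comap L.subtype).dualAnnihilator).comap
      (T.comap L.subtype).dualAnnihilator.subtype).map φ.toLinearMap, ?_⟩ :
        {W : Submodule F (Fin (k + e) → F) // finrank F W = e})) ?_
  · rw [LinearEquiv.finrank_map_eq,
      (Submodule.comapSubtypeEquivOfLe (hann H.1 H.2.1)).finrank_eq]
    have h1 := Subspace.finrank_add_finrank_dualAnnihilator_eq (H.1.comap L.subtype)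
    have h2 := hcom H.1 H.2.2.1
    have h3 := H.2.2.2
    omega
  · rintro ⟨H, hT, hHL, _⟩ ⟨H', hT', hHL', _⟩ heq
    simp only [Subtype.mk.injEq] at heq ⊢
    have h1 := Submodule.map_injective_of_injective φ.injective heq
    have h2 := congrArg (Submodule.map (T.comap L.subtype).dualAnnihilator.subtype) h1
    rw [Submodule.map_comap_subtype, Submodule.map_comap_subtype,
      inf_eq_right.2 (hann H hT), inf_eq_right.2 (hann H' hT')] at h2
    have h3 := Subspace.dualAnnihilator_inj.1 h2
    have h4 := congrArg (Submodule.map L.subtype) h3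
    rwa [Submodule.map_comap_subtype, Submodule.map_comap_subtype,
      inf_eq_right.2 hHL, inf_eq_right.2 hHL'] at h4

open Module in
open scoped Classical in
lemma aux_pigeon {F V : Type*} [Field F] [Fintype F] [AddCommGroup V] [Module F V]
    [FiniteDimensional F V] (T L : Submodule F V) (hTL : T ≤ L) (k e c : ℕ)
    (hL : finrank F L = finrank F T + (k + e))
    (S : Finset (Submodule F V)) (hSL : ∀ W ∈ S, W ≤ L) (hS : ∀ W ∈ S, finrank F W ≤ k)
    (hc : ∀ H : Submodule F V, T ≤ H → H ≤ L → finrank F H = finrank F T + k →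
      (S.filter (fun W => W ≤ H)).card ≤ c) :
    S.card ≤ gaussBinom F (k + e) e * c := by
  have : Finite V := Module.finite_of_finite F
  have hfin : {H : Submodule F V | T ≤ H ∧ H ≤ L ∧ finrank F H = finrank F T + k}.Finite :=
    Set.toFinite _
  have hcard : hfin.toFinset.card ≤ gaussBinom F (k + e) e := by
    rw [← Set.ncard_eq_toFinset_card _ hfin]
    exact aux_count T L hTL k e hL
  have hsub : S ⊆ hfin.toFinset.biUnion (fun H => S.filter (fun W => W ≤ H)) := by
    intro W hW
    have h0 := Submodule.finrank_add_le_finrank_add_finrank W T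
    have h1 := hS W hW
    have h2 : finrank F T ≤ finrank F ↥(W ⊔ T) := Submodule.finrank_mono le_sup_right
    obtain ⟨H, ha, hb, hd⟩ := aux_between (W ⊔ T) L (sup_le (hSL W hW) hTL)
      (finrank F T + k - finrank F ↥(W ⊔ T)) (by omega)
    simp only [Finset.mem_biUnion, Set.Finite.mem_toFinset, Set.mem_ofPred_eq, Finset.mem_filter]
    exact ⟨H, ⟨le_sup_right.trans ha, hb, by omega⟩, hW, le_sup_left.trans ha⟩
  calc S.card ≤ _ := Finset.card_le_card hsub
    _ ≤ hfin.toFinset.card * c := by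
        apply Finset.card_biUnion_le_card_mul
        intro H hH
        simp only [Set.Finite.mem_toFinset, Set.mem_ofPred_eq] at hH
        exact hc H hH.1 hH.2.1 hH.2.2
    _ ≤ _ := Nat.mul_le_mul_right _ hcard

lemma aux_gauss_one (F : Type*) [Field F] [Fintype F] (n : ℕ) :
    gaussBinom F n 1 = (Fintype.card F ^ n - 1) / (Fintype.card F - 1) := by
  unfold gaussBinom
  rw [← Nat.card_congr (Projectivization.equivSubmodule F (Fin n → F)),
    Projectivization.card_of_finrank F (Fin n → F) (n := n) (by simp),
    Nat.card_eq_fintype_card, Nat.geomSum_eq Fintype.one_lt_card]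

open Module in
lemma aux_sup {F V : Type*} [Field F] [AddCommGroup V] [Module F V]
    [FiniteDimensional F V] (k : ℕ) (U : Finset (Submodule F V))
    (hU : ∀ W ∈ U, finrank F W ≤ k) : finrank F ↥(U.sup id) ≤ U.card * k := by
  classical
  induction U using Finset.induction_on with
  | empty => simp
  | insert a s ha ih =>
    rw [Finset.sup_insert, Finset.card_insert_of_notMem ha]
    have h0 := Submodule.finrank_add_le_finrank_add_finrank (id a) (s.sup id)
    have h1 := hU a (Finset.mem_insert_self _ _)
    have h2 := ih (fun W hW => hU W (Finset.mem_insert_of_mem hW))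
    simp only [id] at h0 h2 ⊢
    rw [add_mul]
    omega

/-- Upper bound on the size of a collection of subspaces of `F_q^{ht}`,
each of dimension at most `ℓt`, any `α` of which span a subspace of dimension at least
`(h-ε)t`. -/
theorem stmt_2 (F : Type*) [Field F] [Fintype F]
    (α h ℓ t ε : ℕ) (hα : 2 ≤ α) (hh : 1 ≤ h) (hℓ : 1 ≤ ℓ) (ht : 1 ≤ t)
    (hhe : 2 * ℓ ≤ h - ε)
    (S : Finset (Submodule F (Fin (h * t) → F)))
    (hScard : α ≤ S.card)
    (hdim : ∀ W ∈ S, Module.finrank F W ≤ ℓ * t)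
    (hspan : ∀ U : Finset (Submodule F (Fin (h * t) → F)),
      U ⊆ S → U.card = α → (h - ε) * t ≤ Module.finrank F ↥(U.sup id)) :
    h - ε ≤ α * ℓ ∧
      S.card ≤ gaussBinom F ((ε + ℓ) * t) (ε * t) *
          ((α - (h - ε) / ℓ + 1) *
            ((Fintype.card F ^ (ℓ * t + 1) - 1) / (Fintype.card F - 1)) - 1) +
        ((h - ε) / ℓ - 1) := by
  classical
  set m := h - ε with hm
  set k := ℓ * t with hk
  set r := m / ℓ with hr
  have hkpos : 1 ≤ k := Nat.mul_pos hℓ ht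
  have hr2 : 2 ≤ r := (Nat.le_div_iff_mul_le hℓ).2 hhe
  have hrm : r * ℓ ≤ m := Nat.div_mul_le_self _ _
  have hrk : r * k ≤ m * t := by
    rw [hk, ← mul_assoc]; exact Nat.mul_le_mul_right _ hrm
  have hmα : m ≤ α * ℓ := by
    obtain ⟨U, hU, hUc⟩ := Finset.exists_subset_card_eq hScard
    have h1 := hspan U hU hUc
    have h2 := aux_sup k U (fun W hW => hdim W (hU hW))
    rw [hUc] at h2
    have h3 : m * t ≤ (α * ℓ) * t := by rw [mul_assoc]; exact h1.trans h2
    exact Nat.le_of_mul_le_mul_right h3 ht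
  refine ⟨hmα, ?_⟩
  have hrα : r ≤ α := Nat.le_of_mul_le_mul_right (hrm.trans hmα) hℓ
  have hht : Module.finrank F (Fin (h * t) → F) = m * t + ε * t := by
    rw [← add_mul, hm, Nat.sub_add_cancel (by omega)]; simp
  have hsmall : ∀ H : Submodule F (Fin (h * t) → F), Module.finrank F H < m * t →
      (S.filter (fun W => W ≤ H)).card ≤ α - 1 := by
    intro H hH
    by_contra hcon
    obtain ⟨U, hU, hUc⟩ := Finset.exists_subset_card_eq
      (show α ≤ (S.filter (fun W => W ≤ H)).card by omega)
    have h1 := hspan U (hU.trans (Finset.filter_subset _ _)) hUc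
    have h2 : U.sup id ≤ H := Finset.sup_le fun W hW => (Finset.mem_filter.1 (hU hW)).2
    have h3 := Submodule.finrank_mono h2
    omega
  obtain ⟨R, hRS, hRc⟩ := Finset.exists_subset_card_eq (show r - 1 ≤ S.card by omega)
  obtain ⟨R', hR'R, hR'c⟩ := Finset.exists_subset_card_eq (show r - 2 ≤ R.card by omega)
  have e1 : (r - 1) * k + k = r * k := by
    rw [← Nat.succ_mul]; congr 1; omega
  have e2 : (r - 2) * k + 2 * k = r * k := by
    rw [← add_mul]; congr 1; omega
  have hRd := aux_sup k R (fun W hW => hdim W (hRS hW))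
  have hR'd := aux_sup k R' (fun W hW => hdim W (hRS (hR'R hW)))
  rw [hRc] at hRd
  rw [hR'c] at hR'd
  have htop : Module.finrank F (⊤ : Submodule F (Fin (h * t) → F)) = m * t + ε * t := by
    rw [finrank_top, hht]
  obtain ⟨T, hRT, -, hTd⟩ := aux_between (R.sup id) ⊤ le_top
    (m * t - k - Module.finrank F ↥(R.sup id)) (by omega)
  have hTd' : Module.finrank F T = m * t - k := by omega
  have key := aux_pigeon T ⊤ le_top k (ε * t)
    ((α - r + 1) * ((Fintype.card F ^ (k + 1) - 1) / (Fintype.card F - 1)) - 1)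
    (by omega) (S \ R) (fun _ _ => le_top)
    (fun W hW => hdim W (Finset.mem_sdiff.1 hW).1) ?_
  · have h1 := Finset.card_sdiff_add_card_eq_card hRS
    have h2 : (ε + ℓ) * t = k + ε * t := by rw [hk]; ring
    rw [h2]
    omega
  · intro L hTL _ hLd
    have hRL : R.sup id ≤ L := hRT.trans hTL
    have hR'L : R'.sup id ≤ L := (Finset.sup_mono hR'R).trans hRL
    obtain ⟨T', hRT', hT'L, hT'd⟩ := aux_between (R'.sup id) L hR'L
      (m * t - k - 1 - Module.finrank F ↥(R'.sup id)) (by omega)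
    have hT'd' : Module.finrank F T' = m * t - k - 1 := by omega
    have key2 := aux_pigeon T' L hT'L k 1 (α - r + 1) (by omega)
      ((S.filter (fun W => W ≤ L)) \ R')
      (fun W hW => (Finset.mem_filter.1 (Finset.mem_sdiff.1 hW).1).2)
      (fun W hW => hdim W (Finset.mem_filter.1 (Finset.mem_sdiff.1 hW).1).1) ?_
    · rw [aux_gauss_one] at key2
      have hsub : R' ⊆ S.filter (fun W => W ≤ L) := fun W hW => Finset.mem_filter.2
        ⟨hRS (hR'R hW), (Finset.le_sup (f := id) hW).trans hR'L⟩
      have hsub2 : R ⊆ S.filter (fun W => W ≤ L) := fun W hW => Finset.mem_filter.2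
        ⟨hRS hW, (Finset.le_sup (f := id) hW).trans hRL⟩
      have h1 := Finset.card_sdiff_add_card_eq_card hsub
      have h2 := Finset.card_sdiff_add_card_eq_card hsub2
      have h3 : (S \ R).filter (fun W => W ≤ L) = (S.filter (fun W => W ≤ L)) \ R := by
        ext W; simp only [Finset.mem_filter, Finset.mem_sdiff]; tauto
      rw [h3]
      rw [mul_comm _ (α - r + 1)] at key2
      omega
    · intro H hT'H _ hHd
      have h1 := hsmall H (by omega)
      have hsub : R' ⊆ S.filter (fun W => W ≤ H) := fun W hW => Finset.mem_filter.2
        ⟨hRS (hR'R hW), (Finset.le_sup (f := id) hW).trans (hRT'.trans hT'H)⟩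
      have h2 := Finset.card_sdiff_add_card_eq_card hsub
      have h3 : ((S.filter (fun W => W ≤ L)) \ R').filter (fun W => W ≤ H) ⊆
          (S.filter (fun W => W ≤ H)) \ R' := by
        intro W; simp only [Finset.mem_filter, Finset.mem_sdiff]; tauto
      have h4 := Finset.card_le_card h3
      omega
end

section
/- Let q be a prime power and F_q the field with q elements, and let α ≥ 2, ℓ ≥ 1, t ≥ 1, ε ≥ 0 and h be integers with ℓ + ε < h ≤ 2ℓ + ε. Define g(t) = max{ℓt, (h−ℓ)t} · (min{ℓt, (h−ℓ)t} − (h−ℓ−ε)t + 1); explicitly, g(t) = ℓεt² + ℓt if h ≤ 2ℓ and g(t) = (h−ℓ)(2ℓ+ε−h)t² + (h−ℓ)t otherwise. Then, with r = (α−1)·q^{g(t)}, there exist matrices A₁, …, A_r ∈ F_q^{ℓt × ht} such that for every choice of α distinct indices i₁ < ⋯ < i_α, the (αℓt) × ht matrix obtained by stacking A_{i₁}, …, A_{i_α} vertically has rank at least (h−ε)t; hence the (ε,ℓ)-N_{h,r,αℓ+ε} generalized combination network has a (q,t)-linear solution with r = (α−1)q^{g(t)} middle nodes. -/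
/-- The exponent `g(t) = max{ℓt, (h−ℓ)t} · (min{ℓt, (h−ℓ)t} − (h−ℓ−ε)t + 1)`. -/
def gExp (h ℓ t ε : ℕ) : ℕ :=
  max (ℓ * t) ((h - ℓ) * t) * (min (ℓ * t) ((h - ℓ) * t) - (h - ℓ - ε) * t + 1)

open Polynomial in
/-- Gabidulin evaluation map: the linearized polynomial with coefficients `a`. -/
noncomputable def gabMap (F L : Type*) [Field F] [Fintype F] [Field L] [Algebra F L] (K : ℕ)
    (a : Fin K → L) : L →ₗ[F] L :=
  ∑ i : Fin K, (LinearMap.mulLeft F (a i)) ∘ₗ (FiniteField.frobeniusAlgHom F L ^ (i : ℕ)).toLinearMap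

lemma gabMap_apply (F L : Type*) [Field F] [Fintype F] [Field L] [Algebra F L] (K : ℕ)
    (a : Fin K → L) (x : L) :
    gabMap F L K a x = ∑ i : Fin K, a i * x ^ (Fintype.card F ^ (i : ℕ)) := by
  simp [gabMap, LinearMap.sum_apply, AlgHom.coe_pow, FiniteField.coe_frobeniusAlgHom, pow_iterate]

lemma gabMap_sub (F L : Type*) [Field F] [Fintype F] [Field L] [Algebra F L] (K : ℕ)
    (a b : Fin K → L) : gabMap F L K (a - b) = gabMap F L K a - gabMap F L K b := by
  ext x
  simp [gabMap_apply, sub_mul, Finset.sum_sub_distrib]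

open Polynomial in
lemma gabMap_ker (F L : Type*) [Field F] [Fintype F] [Field L] [Fintype L] [Algebra F L] (K : ℕ)
    (a : Fin K → L) (ha : a ≠ 0) :
    Module.finrank F (LinearMap.ker (gabMap F L K a)) + 1 ≤ K := by
  classical
  have hq : 1 < Fintype.card F := Fintype.one_lt_card
  obtain ⟨j, hj⟩ := Function.ne_iff.mp ha
  set P : L[X] := ∑ i : Fin K, C (a i) * X ^ (Fintype.card F ^ (i : ℕ)) with hP
  have hP0 : P ≠ 0 := by
    intro h0
    have : P.coeff (Fintype.card F ^ (j : ℕ)) = a j := by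
      rw [hP, finsetSum_coeff, Finset.sum_eq_single j]
      · simp
      · intro b _ hb
        rw [coeff_C_mul_X_pow, if_neg]
        intro h
        exact hb (Fin.ext (Nat.pow_right_injective hq h).symm)
      · simp
    rw [h0] at this
    exact hj (by simpa using this.symm)
  have hdeg : P.natDegree ≤ Fintype.card F ^ (K - 1) := by
    refine natDegree_sum_le_of_forall_le _ _ fun i _ => (natDegree_C_mul_X_pow_le _ _).trans ?_
    exact Nat.pow_le_pow_right hq.le (by have := i.2; omega)
  have hcard : Fintype.card F ^ Module.finrank F (LinearMap.ker (gabMap F L K a))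
      ≤ Fintype.card F ^ (K - 1) := by
    rw [← Module.card_eq_pow_finrank]
    refine le_trans ?_ ((Multiset.toFinset_card_le _).trans ((card_roots' P).trans hdeg))
    rw [Fintype.card_subtype]
    refine Finset.card_le_card fun x hx => ?_
    have hx' : gabMap F L K a x = 0 := by simpa using hx
    rw [Multiset.mem_toFinset, mem_roots hP0, IsRoot, hP, eval_finsetSum]
    simpa [gabMap_apply] using hx'
  have := (Nat.pow_le_pow_iff_right hq).mp hcard
  have := j.2
  omega

/-- Maximum rank distance codes, tall case. -/
lemma mrd_tall (F : Type*) [Field F] [Fintype F] (N k K : ℕ) (hN : 0 < N) (hk : k ≤ N) :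
    ∃ C : Fin (Fintype.card F ^ (N * K)) → Matrix (Fin N) (Fin k) F,
      ∀ a b, a ≠ b → k + 1 ≤ (C a - C b).rank + K := by
  classical
  obtain ⟨p, hp⟩ := CharP.exists F
  have hpp : Fact p.Prime := ⟨CharP.char_is_prime F p⟩
  have : NeZero N := ⟨hN.ne'⟩
  let L := FiniteField.Extension F p N
  let _ : Fintype L := Fintype.ofFinite L
  have hfr : Module.finrank F L = N := FiniteField.finrank_extension F p N
  let B : Module.Basis (Fin N) F L := Module.finBasisOfFinrankEq F L hfr
  let φ : (Fin k → F) →ₗ[F] L := Fintype.linearCombination F (fun i => B (Fin.castLE hk i))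
  have hφ : Function.Injective φ := by
    have : LinearIndependent F (fun i => B (Fin.castLE hk i)) :=
      B.linearIndependent.comp _ (Fin.castLE_injective hk)
    exact this.fintypeLinearCombination_injective
  have hc : Fintype.card (Fin (Fintype.card F ^ (N * K))) = Fintype.card (Fin K → L) := by
    rw [Fintype.card_fin, Fintype.card_fun, Fintype.card_fin,
      Module.card_eq_pow_finrank (K := F) (V := L), hfr, pow_mul]
  let E := Fintype.equivOfCardEq hc
  let G : (Fin K → L) → ((Fin k → F) →ₗ[F] (Fin N → F)) := fun a =>
    B.equivFun.toLinearMap ∘ₗ gabMap F L K a ∘ₗ φ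
  refine ⟨fun a => LinearMap.toMatrix' (G (E a)), fun a b hab => ?_⟩
  have hne : E a - E b ≠ 0 := sub_ne_zero.mpr fun h => hab (E.injective h)
  have hker := gabMap_ker F L K _ hne
  have hG : G (E a) - G (E b) = G (E a - E b) := by
    ext x
    simp [G, gabMap_sub]
  rw [← map_sub, hG, Matrix.rank, ← Matrix.toLin'_apply', Matrix.toLin'_toMatrix']
  have h1 := LinearMap.finrank_range_add_finrank_ker (G (E a - E b))
  have h2 : Module.finrank F (LinearMap.ker (G (E a - E b))) ≤
      Module.finrank F (LinearMap.ker (gabMap F L K (E a - E b))) := by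
    let ψ : LinearMap.ker (G (E a - E b)) →ₗ[F] LinearMap.ker (gabMap F L K (E a - E b)) :=
      LinearMap.restrict φ (by
        intro x hx
        rw [LinearMap.mem_ker] at hx ⊢
        exact B.equivFun.map_eq_zero_iff.mp hx)
    refine LinearMap.finrank_le_finrank_of_injective (f := ψ) ?_
    intro x y hxy
    exact Subtype.ext (hφ (congrArg Subtype.val hxy))
  rw [Module.finrank_fin_fun] at h1
  omega

/-- Maximum rank distance codes. -/
lemma mrd (F : Type*) [Field F] [Fintype F] (m n K : ℕ) (hm : 0 < m) :
    ∃ C : Fin (Fintype.card F ^ (max m n * K)) → Matrix (Fin m) (Fin n) F,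
      ∀ a b, a ≠ b → min m n + 1 ≤ (C a - C b).rank + K := by
  rcases le_total n m with h | h
  · rw [max_eq_left h, min_eq_right h]
    exact mrd_tall F m n K hm h
  · rw [max_eq_right h, min_eq_left h]
    obtain ⟨C, hC⟩ := mrd_tall F n m K (hm.trans_le h) h
    refine ⟨fun a => (C a).transpose, fun a b hab => ?_⟩
    rw [← Matrix.transpose_sub, Matrix.rank_transpose]
    exact hC a b hab

/-- Kernel dimension bound for stacked lifted matrices. -/
lemma stack_rank (F : Type*) [Field F] (m n s α : ℕ) (e : Fin s ≃ Fin m ⊕ Fin n)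
    (M : Fin α → Matrix (Fin m) (Fin n) F) (i j : Fin α) :
    m + (M i - M j).rank ≤
      (Matrix.of fun (p : Fin α × Fin m) (c : Fin s) =>
        Matrix.fromCols (1 : Matrix (Fin m) (Fin m) F) (M p.1) p.2 (e c)).rank := by
  classical
  set S := (Matrix.of fun (p : Fin α × Fin m) (c : Fin s) =>
        Matrix.fromCols (1 : Matrix (Fin m) (Fin m) F) (M p.1) p.2 (e c)) with hS
  have hs : s = m + n := by simpa using Fintype.card_congr e
  have key : ∀ v : Fin s → F, S.mulVec v = 0 → ∀ a : Fin α,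
      (fun x => v (e.symm (Sum.inl x))) + (M a).mulVec (fun y => v (e.symm (Sum.inr y))) = 0 := by
    intro v hv a
    ext x
    have := congrFun hv (a, x)
    simp only [Matrix.mulVec, dotProduct, hS, Matrix.of_apply] at this
    rw [← e.symm.sum_comp] at this
    simpa [Fintype.sum_sum_type, Matrix.one_apply, Matrix.mulVec, dotProduct] using this
  have h1 := LinearMap.finrank_range_add_finrank_ker S.mulVecLin
  have h2 := LinearMap.finrank_range_add_finrank_ker (M i - M j).mulVecLin
  rw [Module.finrank_fin_fun] at h1 h2
  have h3 : Module.finrank F (LinearMap.ker S.mulVecLin) ≤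
      Module.finrank F (LinearMap.ker (M i - M j).mulVecLin) := by
    let ψ : LinearMap.ker S.mulVecLin →ₗ[F] LinearMap.ker (M i - M j).mulVecLin :=
      LinearMap.restrict (LinearMap.funLeft F F (fun y => e.symm (Sum.inr y))) (by
        intro v hv
        rw [LinearMap.mem_ker, Matrix.mulVecLin_apply] at hv ⊢
        have hi := key v hv i
        have hj := key v hv j
        rw [Matrix.sub_mulVec]
        have := hi.trans hj.symm
        exact sub_eq_zero.mpr (add_left_cancel this))
    refine LinearMap.finrank_le_finrank_of_injective (f := ψ) ?_
    rw [← LinearMap.ker_eq_bot, LinearMap.ker_eq_bot']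
    rintro ⟨v, hv⟩ hψ
    have hr : (fun y => v (e.symm (Sum.inr y))) = 0 := congrArg Subtype.val hψ
    have hl := key v hv i
    rw [hr, Matrix.mulVec_zero, add_zero] at hl
    apply Subtype.ext
    funext c
    obtain ⟨d, rfl⟩ := e.symm.surjective c
    rcases d with x | y
    · exact congrFun hl x
    · exact congrFun hr y
  unfold Matrix.rank
  omega

/-- Existence of `r = (α−1)·q^{g(t)}` matrices in `F_q^{ℓt×ht}` any `α`
distinct of which stack to a matrix of rank at least `(h−ε)t`; hence the generalized
combination network `(ε,ℓ)-N_{h,r,αℓ+ε}` has a `(q,t)`-linear solution with this many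
middle nodes. -/
theorem stmt_5 (F : Type*) [Field F] [Fintype F]
    (α h ℓ t ε : ℕ) (hα : 2 ≤ α) (hℓ : 1 ≤ ℓ) (ht : 1 ≤ t)
    (hlow : ℓ + ε < h) (hhigh : h ≤ 2 * ℓ + ε) :
    ∃ A : Fin ((α - 1) * Fintype.card F ^ gExp h ℓ t ε) →
        Matrix (Fin (ℓ * t)) (Fin (h * t)) F,
      ∀ f : Fin α → Fin ((α - 1) * Fintype.card F ^ gExp h ℓ t ε),
        Function.Injective f →
          (h - ε) * t ≤
            (Matrix.of fun (p : Fin α × Fin (ℓ * t)) (c : Fin (h * t)) =>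
              A (f p.1) p.2 c).rank := by
  have hm : 0 < ℓ * t := Nat.mul_pos hℓ ht
  obtain ⟨C, hC⟩ : ∃ C : Fin (Fintype.card F ^ gExp h ℓ t ε) →
      Matrix (Fin (ℓ * t)) (Fin ((h - ℓ) * t)) F, ∀ a b, a ≠ b →
        min (ℓ * t) ((h - ℓ) * t) + 1 ≤ (C a - C b).rank +
          (min (ℓ * t) ((h - ℓ) * t) - (h - ℓ - ε) * t + 1) := mrd F (ℓ * t) ((h - ℓ) * t)
    (min (ℓ * t) ((h - ℓ) * t) - (h - ℓ - ε) * t + 1) hm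
  have hst : h * t = ℓ * t + (h - ℓ) * t := by
    rw [← add_mul]; congr 1; omega
  let e : Fin (h * t) ≃ Fin (ℓ * t) ⊕ Fin ((h - ℓ) * t) :=
    (finCongr hst).trans finSumFinEquiv.symm
  let π : Fin ((α - 1) * Fintype.card F ^ gExp h ℓ t ε) → Fin (Fintype.card F ^ gExp h ℓ t ε) :=
    fun x => (finProdFinEquiv.symm x).2
  let σ : Fin ((α - 1) * Fintype.card F ^ gExp h ℓ t ε) → Fin (α - 1) :=
    fun x => (finProdFinEquiv.symm x).1
  refine ⟨fun x => Matrix.of fun r c => Matrix.fromCols 1 (C (π x)) r (e c), fun f hf => ?_⟩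
  have hex : ∃ i j, π (f i) ≠ π (f j) := by
    by_contra! hcon
    have hinj : Function.Injective (fun i => σ (f i)) := by
      intro i j hij
      exact hf (finProdFinEquiv.symm.injective (Prod.ext hij (hcon i j)))
    have := Fintype.card_le_of_injective _ hinj
    simp only [Fintype.card_fin] at this
    omega
  obtain ⟨i, j, hij⟩ := hex
  have h1 := hC _ _ hij
  have h2 := stack_rank F (ℓ * t) ((h - ℓ) * t) (h * t) α e (fun a => C (π (f a))) i j
  have h3 : (h - ℓ - ε) * t ≤ min (ℓ * t) ((h - ℓ) * t) :=
    le_min (Nat.mul_le_mul_right _ (by omega)) (Nat.mul_le_mul_right _ (by omega))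
  have h4 : (h - ε) * t = ℓ * t + (h - ℓ - ε) * t := by
    rw [← add_mul]; congr 1; omega
  refine le_trans ?_ h2
  rw [h4]
  omega
end

section
/- Let ℓ ≥ 1, q = 2^ℓ, let r be an integer with 1 ≤ r ≤ q − 1, and let a, b be integers with 0 ≤ a, b ≤ q − 1. Then the monomial x^a y^b is (Φ, q−r)*-good — i.e., for every α, β, γ ∈ F_q the remainder of X^a·(αX² + βX + γ)^b upon division by X^q − X has degree less than q − r — if and only if for all nonnegative integers i, j with i ≤₂ b and j ≤₂ (b − i) one has (2i + j + a) mod* q < q − r. -/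
open Polynomial

/-- `u ≤₂ v`: every binary digit of `u` is at most the corresponding binary digit
of `v` (the 2-shadow relation). -/
def le2 (u v : ℕ) : Prop := ∀ k, u.testBit k = true → v.testBit k = true

/-- `x mod* q`: equals `x` if `x ≤ q−1`; equals `q−1` if `x > q−1` and `(q−1) ∣ x`;
and equals `x mod (q−1)` otherwise. -/
def modStar (x q : ℕ) : ℕ :=
  if x ≤ q - 1 then x else if (q - 1) ∣ x then q - 1 else x % (q - 1)


lemma aux_choose_odd (n : ℕ) : ∀ k : ℕ, n.choose k % 2 = 1 ↔ le2 k n := by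
  induction n using Nat.strong_induction_on with
  | _ n ih =>
    intro k
    rcases Nat.eq_zero_or_pos n with hn | hn
    · subst hn
      rcases Nat.eq_zero_or_pos k with hk | hk
      · subst hk; simp [le2]
      · rw [Nat.choose_eq_zero_of_lt hk]
        simp only [Nat.zero_mod, zero_ne_one, false_iff, le2]
        intro h
        obtain ⟨i, hi⟩ := Nat.exists_testBit_of_ne_zero hk.ne'
        have := h i hi
        simp at this
    · have : Fact (Nat.Prime 2) := ⟨Nat.prime_two⟩
      have hL : n.choose k % 2 = ((n % 2).choose (k % 2) * (n / 2).choose (k / 2)) % 2 :=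
        Choose.choose_modEq_choose_mod_mul_choose_div_nat (n := n) (k := k) (p := 2)
      have h2 := ih (n / 2) (by omega) (k / 2)
      have hle : le2 k n ↔ ((k % 2 = 1 → n % 2 = 1) ∧ le2 (k / 2) (n / 2)) := by
        constructor
        · intro h
          refine ⟨?_, ?_⟩
          · have := h 0
            simpa [Nat.testBit_zero] using this
          · intro i hi
            have := h (i + 1)
            rw [Nat.testBit_succ, Nat.testBit_succ] at this
            exact this hi
        · rintro ⟨h0, h1⟩ i
          cases i with
          | zero => simpa [Nat.testBit_zero] using h0
          | succ i =>
            rw [Nat.testBit_succ, Nat.testBit_succ]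
            exact h1 i
      rw [hL, hle, ← h2]
      rcases Nat.mod_two_eq_zero_or_one n with hn2 | hn2 <;>
      rcases Nat.mod_two_eq_zero_or_one k with hk2 | hk2 <;> simp [hn2, hk2]

lemma aux_choose_ne {F : Type*} [Field F] [CharP F 2] (n k : ℕ) :
    (n.choose k : F) ≠ 0 ↔ le2 k n := by
  rw [← aux_choose_odd, Ne, CharP.cast_eq_zero_iff F 2]
  omega

lemma aux_vanish {F : Type*} [Field F] [Fintype F] (n : ℕ) (hn : n ≤ Fintype.card F)
    (f : ℕ → F) (h : ∀ x : F, ∑ k ∈ Finset.range n, f k * x ^ k = 0) :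
    ∀ k < n, f k = 0 := by
  intro k hk
  set p : F[X] := ∑ k ∈ Finset.range n, C (f k) * X ^ k with hp
  have hdeg : p.degree < n := by
    rw [degree_lt_iff_coeff_zero]
    intro m hm
    simp only [hp, finsetSum_coeff, coeff_C_mul_X_pow]
    refine Finset.sum_eq_zero fun i hi => ?_
    have := Finset.mem_range.1 hi
    rw [if_neg (by omega)]
  have hp0 : p = 0 := by
    by_contra hne
    have h1 : p.natDegree < n := (natDegree_lt_iff_degree_lt hne).2 hdeg
    refine hne (eq_zero_of_natDegree_lt_card_of_eval_eq_zero' p Finset.univ ?_ ?_)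
    · intro x _
      simp only [hp, eval_finsetSum, eval_mul, eval_C, eval_pow, eval_X]
      exact h x
    · rw [Finset.card_univ]; omega
  have : p.coeff k = f k := by
    simp only [hp, finsetSum_coeff, coeff_C_mul_X_pow]
    simp [hk]
  rw [← this, hp0, coeff_zero]

lemma aux_monic {F : Type*} [Field F] (q : ℕ) (hq : 2 ≤ q) : (X ^ q - X : F[X]).Monic :=
  monic_X_pow_sub (by rw [degree_X]; exact_mod_cast hq)

lemma aux_deg {F : Type*} [Field F] (q : ℕ) (hq : 2 ≤ q) : (X ^ q - X : F[X]).degree = q := by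
  rw [degree_sub_eq_left_of_degree_lt] <;> rw [degree_X_pow]
  rw [degree_X]; exact_mod_cast hq

lemma aux_modStar_step (q n : ℕ) (hq : 2 ≤ q) (hn : q ≤ n) :
    modStar n q = modStar (n - (q - 1)) q := by
  obtain ⟨s, rfl⟩ : ∃ s, q = s + 1 := ⟨q - 1, by omega⟩
  obtain ⟨m, rfl⟩ : ∃ m, n = m + s := ⟨n - s, by omega⟩
  simp only [modStar, Nat.add_sub_cancel, Nat.dvd_add_self_right, Nat.add_mod_right]
  rw [if_neg (by omega)]
  by_cases h : m ≤ s
  · rw [if_pos h]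
    rcases h.lt_or_eq with h' | h'
    · rw [if_neg (fun hd => by have := Nat.le_of_dvd (by omega) hd; omega), Nat.mod_eq_of_lt h']
    · subst h'; simp
  · rw [if_neg h]

lemma aux_mod {F : Type*} [Field F] (q : ℕ) (hq : 2 ≤ q) (n : ℕ) :
    (X ^ n : F[X]) %ₘ (X ^ q - X) = X ^ modStar n q := by
  induction n using Nat.strong_induction_on with
  | _ n ih =>
    by_cases h : n ≤ q - 1
    · rw [modStar, if_pos h, (modByMonic_eq_self_iff (aux_monic q hq)), aux_deg q hq, degree_X_pow]
      exact_mod_cast (by omega : n < q)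
    · rw [aux_modStar_step q n hq (by omega), ← ih (n - (q - 1)) (by omega)]
      rw [← sub_eq_zero, ← sub_modByMonic, modByMonic_eq_zero_iff_dvd (aux_monic q hq)]
      refine ⟨X ^ (n - q), ?_⟩
      rw [sub_mul, ← pow_add, ← pow_succ']
      congr 2 <;> congr 1 <;> omega

lemma aux_add_pow {R : Type*} [CommSemiring R] (x y : R) (n N : ℕ) (h : n ≤ N) :
    (x + y) ^ n = ∑ m ∈ Finset.range (N + 1), x ^ m * y ^ (n - m) * (n.choose m : R) := by
  rw [add_pow]
  refine Finset.sum_subset (Finset.range_mono (by omega)) ?_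
  intro m _ hm
  rw [Finset.mem_range] at hm
  rw [Nat.choose_eq_zero_of_lt (by omega)]; simp

lemma aux_coeff {F : Type*} [Field F] (q : ℕ) (hq : 2 ≤ q) (a b : ℕ) (α β γ : F) (d : ℕ) :
    ((X ^ a * (C α * X ^ 2 + C β * X + C γ) ^ b) %ₘ (X ^ q - X)).coeff d =
      ∑ i ∈ Finset.range (b + 1), ∑ j ∈ Finset.range (b + 1),
        (if d = modStar (2 * i + j + a) q then
          ((b.choose i : F) * ((b - i).choose j : F)) else 0) *
            (α ^ i * β ^ j * γ ^ (b - i - j)) := by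
  have hexp : (X ^ a * (C α * X ^ 2 + C β * X + C γ) ^ b : F[X]) =
      ∑ i ∈ Finset.range (b + 1), ∑ j ∈ Finset.range (b + 1),
        ((b.choose i : F) * ((b - i).choose j : F) * (α ^ i * β ^ j * γ ^ (b - i - j))) •
          X ^ (2 * i + j + a) := by
    rw [add_assoc, aux_add_pow _ _ b b le_rfl, Finset.mul_sum]
    refine Finset.sum_congr rfl fun i _ => ?_
    rw [aux_add_pow _ _ (b - i) b (Nat.sub_le _ _), Finset.mul_sum, Finset.sum_mul, Finset.mul_sum]
    refine Finset.sum_congr rfl fun j _ => ?_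
    rw [smul_eq_C_mul]
    simp only [map_mul, map_pow, map_natCast]
    ring
  rw [hexp]
  change (modByMonicHom (X ^ q - X) _).coeff d = _
  simp only [map_sum, map_smul, finsetSum_coeff]
  refine Finset.sum_congr rfl fun i _ => Finset.sum_congr rfl fun j _ => ?_
  rw [modByMonicHom_apply, aux_mod q hq, coeff_smul, coeff_X_pow, smul_eq_mul]
  split_ifs <;> ring

/-- A monomial `x^a y^b` is `(Φ, q−r)*`-good iff
`(2i + j + a) mod* q < q − r` for all `i ≤₂ b` and `j ≤₂ (b − i)`. -/
theorem stmt_7 (F : Type*) [Field F] [Fintype F]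
    (ℓ : ℕ) (hℓ : 1 ≤ ℓ) (hF : Fintype.card F = 2 ^ ℓ)
    (r : ℕ) (hr1 : 1 ≤ r) (hr2 : r ≤ 2 ^ ℓ - 1)
    (a b : ℕ) (ha : a ≤ 2 ^ ℓ - 1) (hb : b ≤ 2 ^ ℓ - 1) :
    (∀ α β γ : F,
        ((X ^ a * (C α * X ^ 2 + C β * X + C γ) ^ b) %ₘ (X ^ (2 ^ ℓ) - X)).degree <
          ((2 ^ ℓ - r : ℕ) : WithBot ℕ)) ↔
      ∀ i j : ℕ, le2 i b → le2 j (b - i) →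
        modStar (2 * i + j + a) (2 ^ ℓ) < 2 ^ ℓ - r := by
  have hq : 2 ≤ 2 ^ ℓ := by
    calc 2 = 2 ^ 1 := rfl
      _ ≤ 2 ^ ℓ := Nat.pow_le_pow_right (by norm_num) hℓ
  have : CharP F 2 := by
    have : Fact (Nat.Prime 2) := ⟨Nat.prime_two⟩
    exact charP_of_card_eq_prime_pow hF
  simp only [degree_lt_iff_coeff_zero, aux_coeff _ hq]
  constructor
  · intro H i j hi hj
    by_contra hlt
    set d := modStar (2 * i + j + a) (2 ^ ℓ) with hd
    have hci : (b.choose i : F) ≠ 0 := (aux_choose_ne _ _).2 hi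
    have hcj : ((b - i).choose j : F) ≠ 0 := (aux_choose_ne _ _).2 hj
    have hib : i < b + 1 := by
      by_contra h
      exact hci (by rw [Nat.choose_eq_zero_of_lt (by omega)]; simp)
    have hjb : j < b + 1 := by
      by_contra h
      exact hcj (by rw [Nat.choose_eq_zero_of_lt (by omega)]; simp)
    have hcard : b + 1 ≤ Fintype.card F := by omega
    have h1 := fun α => aux_vanish (b + 1) hcard
      (fun j => ∑ i ∈ Finset.range (b + 1), (if d = modStar (2 * i + j + a) (2 ^ ℓ) then
          ((b.choose i : F) * ((b - i).choose j : F)) else 0) * α ^ i) (by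
        intro β
        have := H α β 1 d (by omega)
        rw [Finset.sum_comm] at this
        refine Eq.trans ?_ this
        refine Finset.sum_congr rfl fun j _ => ?_
        rw [Finset.sum_mul]
        refine Finset.sum_congr rfl fun i _ => ?_
        rw [one_pow]; ring) j hjb
    have h2 := aux_vanish (b + 1) hcard _ h1 i hib
    rw [if_pos hd] at h2
    exact mul_ne_zero hci hcj h2
  · intro H α β γ d hd
    refine Finset.sum_eq_zero fun i _ => Finset.sum_eq_zero fun j _ => ?_
    split_ifs with h
    · by_cases hi : le2 i b
      · by_cases hj : le2 j (b - i)
        · have := H i j hi hj; omega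
        · rw [← aux_choose_ne (F := F), not_not] at hj
          rw [hj]; simp
      · rw [← aux_choose_ne (F := F), not_not] at hi
        rw [hi]; simp
    · simp
end
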